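/- arXiv:2412.17841 — 3 statements merged into one kernel-verified Lean document; each statement's English description precedes it below -/
import Mathlib

section
/- Case 3 of the correctness proposition: for every binary vector x ∈ {0,1}^n with x_i = 1 and x_j = 0, setting the ancilla bit to 0 gives H_mod(x, 0) = H(x) + z - ∑_{k ∈ U, x_k = 1} Q_{i,k}. In particular, if z = ∑_{1 ≤ p ≤ q ≤ n} |Q_{p,q}|, then H_mod(x, 0) ≥ H(x). -/
/-- The QUBO energy `H(x) = ∑_{p ≤ q} x_p x_q Q_{p,q}`. -/
def energy {m : ℕ} (A : Matrix (Fin m) (Fin m) ℝ) (x : Fin m → ℝ) : ℝ :=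
  ∑ p : Fin m, ∑ q ∈ Finset.Ici p, x p * x q * A p q

/-- `x` is a binary ({0,1}-valued) vector. -/
def IsBinary {m : ℕ} (x : Fin m → ℝ) : Prop := ∀ p, x p = 0 ∨ x p = 1

/-- The row/column of the ancilla qubit in the enhanced matrix. -/
def ancRow {n : ℕ} (Q : Matrix (Fin n) (Fin n) ℝ) (i j : Fin n) (U : Finset (Fin n)) (z : ℝ)
    (k : Fin n) : ℝ :=
  if k = i ∨ k = j then -2 * z else if k ∈ U then Q i k else 0

/-- The enhanced matrix restricted to the original `n × n` block. -/
def coreMod {n : ℕ} (Q : Matrix (Fin n) (Fin n) ℝ) (i j : Fin n) (U : Finset (Fin n)) (z : ℝ) :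
    Matrix (Fin n) (Fin n) ℝ := fun p q =>
  if p = i ∧ q = i then Q i i + z
  else if p = j ∧ q = j then Q j j + z
  else if (p = i ∧ q = j) ∨ (p = j ∧ q = i) then 2 * z
  else if ((p = i ∨ p = j) ∧ q ∈ U) ∨ (p ∈ U ∧ (q = i ∨ q = j)) then 0
  else Q p q

/-- The enhanced `(n+1) × (n+1)` matrix `Q_mod`, the ancilla being the last index. -/
def QMod {n : ℕ} (Q : Matrix (Fin n) (Fin n) ℝ) (i j : Fin n) (U : Finset (Fin n)) (z : ℝ) :
    Matrix (Fin (n + 1)) (Fin (n + 1)) ℝ := fun p q =>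
  Fin.lastCases
    (Fin.lastCases z (fun k => ancRow Q i j U z k) q)
    (fun p' => Fin.lastCases (ancRow Q i j U z p') (fun q' => coreMod Q i j U z p' q') q)
    p

/-- The modified energy `H_mod(x, b)`: the energy of `x` extended by the ancilla value `b`. -/
noncomputable def energyMod {n : ℕ} (Q : Matrix (Fin n) (Fin n) ℝ) (i j : Fin n)
    (U : Finset (Fin n)) (z : ℝ) (x : Fin n → ℝ) (b : ℝ) : ℝ :=
  energy (QMod Q i j U z) (Fin.snoc x b)

/-- `z = ∑_{p ≤ q} |Q_{p,q}|`, the value of `z` used in the correctness proposition. -/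
def totalWeight {n : ℕ} (Q : Matrix (Fin n) (Fin n) ℝ) : ℝ :=
  ∑ p : Fin n, ∑ q ∈ Finset.Ici p, |Q p q|

theorem sum_Ici_eq_sum_ite {m : ℕ} (f : Fin m → Fin m → ℝ) :
    ∑ p, ∑ q ∈ Finset.Ici p, f p q = ∑ p, ∑ q, if p ≤ q then f p q else 0 := by
  refine Finset.sum_congr rfl fun p _ => ?_
  rw [← Finset.sum_filter]
  congr 1
  ext q
  simp

/-- Extending a vector by a vanishing last entry restricts the energy to the leading block. -/
theorem energy_snoc_zero {n : ℕ} (A : Matrix (Fin (n + 1)) (Fin (n + 1)) ℝ) (x : Fin n → ℝ) :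
    energy A (Fin.snoc x 0 : Fin (n + 1) → ℝ)
      = energy (A.submatrix Fin.castSucc Fin.castSucc) x := by
  simp only [energy, sum_Ici_eq_sum_ite]
  simp [Fin.sum_univ_castSucc]

theorem energyMod_zero {n : ℕ} (Q : Matrix (Fin n) (Fin n) ℝ) (i j : Fin n)
    (U : Finset (Fin n)) (z : ℝ) (x : Fin n → ℝ) :
    energyMod Q i j U z x 0 = energy (coreMod Q i j U z) x := by
  rw [energyMod, energy_snoc_zero]
  congr 1
  ext p q
  simp [QMod]

/-- In a sum over unordered pairs, the pairs containing `i` are indexed by the other element. -/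
theorem sum_Ici_star {n : ℕ} (i : Fin n) (g : Fin n → ℝ) (hg : g i = 0) :
    ∑ p, ∑ q ∈ Finset.Ici p, ((if p = i then g q else 0) + (if q = i then g p else 0))
      = ∑ k, g k := by
  have h₁ : ∑ p, ∑ q ∈ Finset.Ici p, (if p = i then g q else 0)
      = ∑ k, if i ≤ k then g k else 0 := by
    rw [sum_Ici_eq_sum_ite, Finset.sum_comm]
    refine Finset.sum_congr rfl fun q _ => ?_
    rw [Finset.sum_eq_single i] <;> simp +contextual
  have h₂ : ∑ p, ∑ q ∈ Finset.Ici p, (if q = i then g p else 0)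
      = ∑ k, if k ≤ i then g k else 0 := by
    rw [sum_Ici_eq_sum_ite]
    refine Finset.sum_congr rfl fun p _ => ?_
    rw [Finset.sum_eq_single i] <;> simp +contextual
  simp only [Finset.sum_add_distrib]
  rw [h₁, h₂, ← Finset.sum_add_distrib]
  refine Finset.sum_congr rfl fun k _ => ?_
  rcases lt_trichotomy i k with h | rfl | h
  · simp [h.le, h.not_ge]
  · simp [hg]
  · simp [h.le, h.not_ge]

theorem sum_Ici_diag {n : ℕ} (i : Fin n) (z : ℝ) :
    ∑ p, ∑ q ∈ Finset.Ici p, (if p = i ∧ q = i then z else 0) = z := by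
  rw [Finset.sum_eq_single i]
  · rw [Finset.sum_eq_single i] <;> simp +contextual
  · intro p _ hp
    simp [hp]
  · simp

/-- A sum of entries of one row of a symmetric matrix, off the diagonal, is at most the total
weight. -/
theorem sum_row_le_totalWeight {n : ℕ} (Q : Matrix (Fin n) (Fin n) ℝ) (hQ : Q.IsSymm)
    (i : Fin n) (S : Finset (Fin n)) (hi : i ∉ S) : ∑ k ∈ S, Q i k ≤ totalWeight Q := by
  rw [← Finset.sum_ite_mem_eq,
    ← sum_Ici_star i (fun k => if k ∈ S then Q i k else 0) (by simp [hi])]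
  refine Finset.sum_le_sum fun p _ => Finset.sum_le_sum fun q _ => ?_
  have hs : Q q p = Q p q := hQ.apply p q
  have h₀ := abs_nonneg (Q p q)
  have h₁ := le_abs_self (Q p q)
  grind

theorem case3_xi1_xj0_anc0 {n : ℕ} (Q : Matrix (Fin n) (Fin n) ℝ) (hQ : Q.IsSymm)
    (i j : Fin n) (hij : i ≠ j) (U : Finset (Fin n)) (hiU : i ∉ U) (hjU : j ∉ U)
    (hU : ∀ k ∈ U, Q i k = Q j k) (z : ℝ)
    (x : Fin n → ℝ) (hx : IsBinary x) (hxi : x i = 1) (hxj : x j = 0) :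
    (energyMod Q i j U z x 0
      = energy Q x + z - ∑ k ∈ U.filter (fun k => x k = 1), Q i k) ∧
    (z = totalWeight Q → energyMod Q i j U z x 0 ≥ energy Q x) := by
  have key : energyMod Q i j U z x 0
      = energy Q x + z - ∑ k ∈ U.filter (fun k => x k = 1), Q i k := by
    rw [energyMod_zero, ← Finset.sum_ite_mem_eq (U.filter _),
      ← sum_Ici_star i (fun k => if k ∈ U.filter (fun k => x k = 1) then Q i k else 0)
        (by simp [hiU])]
    conv_rhs => rw [← sum_Ici_diag i z]
    simp only [energy, ← Finset.sum_add_distrib, ← Finset.sum_sub_distrib]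
    refine Finset.sum_congr rfl fun p _ => Finset.sum_congr rfl fun q _ => ?_
    have hs : Q q p = Q p q := hQ.apply p q
    have hp := hx p
    have hq := hx q
    simp only [coreMod, Finset.mem_filter]
    grind
  refine ⟨key, fun hz => ?_⟩
  have h := sum_row_le_totalWeight Q hQ i (U.filter fun k => x k = 1) (by simp [hiU])
  rw [key]
  linarith
end

section
/- Case 4 of the correctness proposition: for every binary vector x ∈ {0,1}^n with x_i = 1 and x_j = 0, setting the ancilla bit to 1 preserves the energy exactly: H_mod(x, 1) = H(x). (No condition on z is needed.) -/
theorem energy_eq_sum_ite {m : ℕ} (A : Matrix (Fin m) (Fin m) ℝ) (x : Fin m → ℝ) :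
    energy A x = ∑ p, ∑ q, if p ≤ q then x p * x q * A p q else 0 := by
  unfold energy
  refine Finset.sum_congr rfl fun p _ => ?_
  rw [← Finset.sum_filter]
  congr 1
  ext q
  simp

theorem energyMod_eq_energy_coreMod_add {n : ℕ} (Q : Matrix (Fin n) (Fin n) ℝ) (i j : Fin n)
    (U : Finset (Fin n)) (z : ℝ) (x : Fin n → ℝ) (b : ℝ) :
    energyMod Q i j U z x b =
      energy (coreMod Q i j U z) x + ∑ k, x k * b * ancRow Q i j U z k + b * b * z := by
  have hlast (k : Fin n) : ¬ Fin.last n ≤ k.castSucc := not_le.2 k.castSucc_lt_last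
  unfold energyMod
  simp only [energy_eq_sum_ite, Fin.sum_univ_castSucc, Finset.sum_add_distrib]
  simp [QMod, Fin.le_last, hlast, add_assoc]

theorem ite_mul_coreMod_eq {n : ℕ} (Q : Matrix (Fin n) (Fin n) ℝ) (hQ : Q.IsSymm)
    (i j : Fin n) (hij : i ≠ j) (U : Finset (Fin n)) (hiU : i ∉ U) (z : ℝ)
    (x : Fin n → ℝ) (hxi : x i = 1) (hxj : x j = 0) (p q : Fin n) :
    (if p ≤ q then x p * x q * coreMod Q i j U z p q else 0) =
      (if p ≤ q then x p * x q * Q p q else 0) + (if p = i then if q = i then z else 0 else 0)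
      - (if p = i then if i ≤ q ∧ q ∈ U then x q * Q i q else 0 else 0)
      - (if q = i then if p ≤ i ∧ p ∈ U then x p * Q i p else 0 else 0) := by
  have hs : Q p i = Q i p := hQ.apply i p
  unfold coreMod
  by_cases hpj : p = j
  · subst hpj
    simp [hxj, hij.symm]
  by_cases hqj : q = j
  · subst hqj
    simp [hxj, hij.symm]
  by_cases hpi : p = i
  · subst hpi
    by_cases hqi : q = p
    · subst hqi
      simp [hxi, hiU]
    · by_cases hqU : q ∈ U <;> by_cases hle : p ≤ q <;> simp [*]
  · by_cases hqi : q = i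
    · subst hqi
      by_cases hpU : p ∈ U <;> by_cases hle : p ≤ q <;> simp [*]
    · simp [*]

theorem case4_xi1_xj0_anc1 {n : ℕ} (Q : Matrix (Fin n) (Fin n) ℝ) (hQ : Q.IsSymm)
    (i j : Fin n) (hij : i ≠ j) (U : Finset (Fin n)) (hiU : i ∉ U) (hjU : j ∉ U)
    (hU : ∀ k ∈ U, Q i k = Q j k) (z : ℝ)
    (x : Fin n → ℝ) (hx : IsBinary x) (hxi : x i = 1) (hxj : x j = 0) :
    energyMod Q i j U z x 1 = energy Q x := by
  have hanc (k : Fin n) : x k * 1 * ancRow Q i j U z k = (if k = i then -2 * z else 0)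
      + (if i ≤ k ∧ k ∈ U then x k * Q i k else 0)
      + (if k ≤ i ∧ k ∈ U then x k * Q i k else 0) := by
    unfold ancRow
    by_cases hki : k = i
    · subst hki
      simp [hxi, hiU]
    by_cases hkj : k = j
    · subst hkj
      simp [hxj, hki]
    by_cases hkU : k ∈ U
    · rcases lt_or_gt_of_ne hki with h | h <;> simp [hki, hkj, hkU, h.le, h.not_ge]
    · simp [hki, hkj, hkU]
  rw [energyMod_eq_energy_coreMod_add]
  simp only [hanc, energy_eq_sum_ite, ite_mul_coreMod_eq Q hQ i j hij U hiU z x hxi hxj,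
    Finset.sum_add_distrib, Finset.sum_sub_distrib]
  have hrow (f : Fin n → ℝ) : ∑ p, ∑ q, (if p = i then f q else 0) = ∑ q, f q := by
    rw [Finset.sum_comm]
    simp
  rw [hrow, hrow]
  simp only [Finset.sum_ite_eq', Finset.mem_univ, if_true]
  ring
end

section
/- Case 8 of the correctness proposition: for every binary vector x ∈ {0,1}^n with x_i = 1 and x_j = 1, setting the ancilla bit to 1 gives H_mod(x, 1) = H(x) + z - Q_{i,j} - ∑_{k ∈ U, x_k = 1} Q_{i,k}. In particular, if z = ∑_{1 ≤ p ≤ q ≤ n} |Q_{p,q}|, then H_mod(x, 1) ≥ H(x). -/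
/-- For a symmetric matrix, twice the energy is the full quadratic form plus the diagonal. -/
lemma two_mul_energy {m : ℕ} (A : Matrix (Fin m) (Fin m) ℝ) (hA : ∀ p q, A p q = A q p)
    (x : Fin m → ℝ) :
    2 * energy A x = (∑ p, ∑ q, x p * x q * A p q) + ∑ p, x p * x p * A p p := by
  have hupper : energy A x = ∑ p, ∑ q, if p ≤ q then x p * x q * A p q else 0 := by
    unfold energy
    refine Finset.sum_congr rfl fun p _ => ?_
    rw [← Finset.sum_filter]
    congr 1
    ext q
    simp
  have hlower : energy A x = ∑ p, ∑ q, if q ≤ p then x p * x q * A p q else 0 := by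
    rw [hupper, Finset.sum_comm]
    refine Finset.sum_congr rfl fun p _ => Finset.sum_congr rfl fun q _ => ?_
    rw [hA q p, mul_comm (x q)]
  have hdiag : ∑ p, x p * x p * A p p = ∑ p, ∑ q, if p = q then x p * x q * A p q else 0 := by
    simp
  rw [two_mul, hdiag]
  nth_rewrite 1 [hupper]
  rw [hlower]
  simp only [← Finset.sum_add_distrib]
  refine Finset.sum_congr rfl fun p _ => Finset.sum_congr rfl fun q _ => ?_
  rcases lt_trichotomy p q with h | h | h
  · simp [h.le, h.not_ge, h.ne]
  · simp [h]
  · simp [h.le, h.not_ge, h.ne']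

lemma coreMod_symm {n : ℕ} {Q : Matrix (Fin n) (Fin n) ℝ} (hQ : ∀ p q, Q p q = Q q p)
    (i j : Fin n) (U : Finset (Fin n)) (z : ℝ) (p q : Fin n) :
    coreMod Q i j U z p q = coreMod Q i j U z q p := by
  unfold coreMod
  have := hQ p q
  grind

lemma QMod_symm {n : ℕ} {Q : Matrix (Fin n) (Fin n) ℝ} (hQ : ∀ p q, Q p q = Q q p)
    (i j : Fin n) (U : Finset (Fin n)) (z : ℝ) (p q : Fin (n + 1)) :
    QMod Q i j U z p q = QMod Q i j U z q p := by
  unfold QMod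
  induction p using Fin.lastCases <;> induction q using Fin.lastCases <;>
    simp [coreMod_symm hQ i j U z]

/-- The modified energy splits into the core energy and the contribution of the ancilla. -/
lemma energyMod_eq {n : ℕ} {Q : Matrix (Fin n) (Fin n) ℝ} (hQ : ∀ p q, Q p q = Q q p)
    (i j : Fin n) (U : Finset (Fin n)) (z : ℝ) (x : Fin n → ℝ) (b : ℝ) :
    energyMod Q i j U z x b =
      energy (coreMod Q i j U z) x + b * ∑ p, x p * ancRow Q i j U z p + b * b * z := by
  have h1 := two_mul_energy _ (QMod_symm hQ i j U z) (Fin.snoc x b)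
  have h2 := two_mul_energy _ (coreMod_symm hQ i j U z) x
  have h3 : ∑ p, x p * b * ancRow Q i j U z p = b * ∑ p, x p * ancRow Q i j U z p := by
    rw [Finset.mul_sum]
    exact Finset.sum_congr rfl fun p _ => by ring
  have h4 : ∑ p, b * x p * ancRow Q i j U z p = b * ∑ p, x p * ancRow Q i j U z p := by
    rw [Finset.mul_sum]
    exact Finset.sum_congr rfl fun p _ => by ring
  simp only [Fin.sum_univ_castSucc, Fin.snoc_castSucc, Fin.snoc_last, QMod, Fin.lastCases_last,
    Fin.lastCases_castSucc, Finset.sum_add_distrib, h3, h4] at h1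
  unfold energyMod
  linarith

lemma sum_mul_ancRow {n : ℕ} (Q : Matrix (Fin n) (Fin n) ℝ) {i j : Fin n} (hij : i ≠ j)
    {U : Finset (Fin n)} (hiU : i ∉ U) (hjU : j ∉ U) (z : ℝ) (x : Fin n → ℝ) :
    ∑ p, x p * ancRow Q i j U z p = -2 * z * (x i + x j) + ∑ k ∈ U, x k * Q i k := by
  have h : ∀ p, x p * ancRow Q i j U z p =
      (if p = i then -2 * z * x p else 0) + (if p = j then -2 * z * x p else 0) +
        (if p ∈ U then x p * Q i p else 0) := by
    intro p
    unfold ancRow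
    grind
  simp only [h, Finset.sum_add_distrib, Finset.sum_ite_eq', Finset.mem_univ, if_true,
    Finset.sum_ite_mem, Finset.univ_inter]
  ring

/-- The core energy in terms of the original one. -/
lemma energy_coreMod {n : ℕ} {Q : Matrix (Fin n) (Fin n) ℝ} (hQ : ∀ p q, Q p q = Q q p)
    {i j : Fin n} (hij : i ≠ j) {U : Finset (Fin n)} (hiU : i ∉ U) (hjU : j ∉ U)
    (hU : ∀ k ∈ U, Q i k = Q j k) (z : ℝ) (x : Fin n → ℝ) :
    energy (coreMod Q i j U z) x =
      energy Q x + z * (x i * x i + x j * x j) + (2 * z - Q i j) * (x i * x j) -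
        (x i + x j) * ∑ k ∈ U, x k * Q i k := by
  have h1 := two_mul_energy _ (coreMod_symm hQ i j U z) x
  have h2 := two_mul_energy Q hQ x
  have hentry : ∀ p q, x p * x q * coreMod Q i j U z p q = x p * x q * Q p q +
      (if p = i then if q = i then x p * x q * z else 0 else 0) +
      (if p = j then if q = j then x p * x q * z else 0 else 0) +
      (if p = i then if q = j then x p * x q * (2 * z - Q i j) else 0 else 0) +
      (if p = j then if q = i then x p * x q * (2 * z - Q i j) else 0 else 0) +
      (if p = i then if q ∈ U then x p * (-(x q * Q i q)) else 0 else 0) +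
      (if p = j then if q ∈ U then x p * (-(x q * Q i q)) else 0 else 0) +
      (if p ∈ U then if q = i then x q * (-(x p * Q i p)) else 0 else 0) +
      (if p ∈ U then if q = j then x q * (-(x p * Q i p)) else 0 else 0) := by
    intro p q
    have hUp := hU p
    have hUq := hU q
    have hpq := hQ p q
    unfold coreMod
    by_cases hpi : p = i <;> by_cases hpj : p = j <;> by_cases hqi : q = i <;>
      by_cases hqj : q = j <;> by_cases hp : p ∈ U <;> by_cases hq : q ∈ U <;> grind
  have hrow : ∀ (a : Fin n) (f : Fin n → Fin n → ℝ),
      (∑ p, ∑ q, if p = a then f p q else 0) = ∑ q, f a q := by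
    intro a f
    rw [Finset.sum_comm]
    simp
  have hmem : ∀ f : Fin n → Fin n → ℝ,
      (∑ p, ∑ q, if p ∈ U then f p q else 0) = ∑ p ∈ U, ∑ q, f p q := by
    intro f
    rw [Finset.sum_comm]
    simp only [Finset.sum_ite_mem, Finset.univ_inter]
    exact Finset.sum_comm
  simp only [hentry, hij, hij.symm, hiU, hjU, if_false, add_zero,
    Finset.sum_add_distrib, hrow, hmem, Finset.sum_ite_eq', Finset.mem_univ, if_true,
    Finset.sum_ite_mem, Finset.univ_inter, ← Finset.mul_sum, Finset.sum_neg_distrib] at h1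
  linarith

/-- The total weight dominates the absolute sum of any single row. -/
lemma sum_abs_row_le_totalWeight {n : ℕ} {Q : Matrix (Fin n) (Fin n) ℝ}
    (hQ : ∀ p q, Q p q = Q q p) (i : Fin n) : ∑ q, |Q i q| ≤ totalWeight Q := by
  have h := two_mul_energy (fun p q => |Q p q|) (fun p q => by rw [hQ]) (fun _ => 1)
  have he : energy (fun p q => |Q p q|) (fun _ => 1) = totalWeight Q := by
    simp [energy, totalWeight]
  simp only [he, one_mul] at h
  have hfull : ∑ p, ∑ q, |Q p q| =
      ∑ q, |Q i q| + ∑ p ∈ Finset.univ.erase i, ∑ q, |Q p q| :=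
    (Finset.add_sum_erase _ _ (Finset.mem_univ i)).symm
  have hcol : ∑ p ∈ Finset.univ.erase i, |Q i p| ≤
      ∑ p ∈ Finset.univ.erase i, ∑ q, |Q p q| := by
    refine Finset.sum_le_sum fun p _ => ?_
    rw [hQ i p]
    exact Finset.single_le_sum (f := fun q => |Q p q|) (fun q _ => abs_nonneg _)
      (Finset.mem_univ i)
  have hsplit : |Q i i| + ∑ p ∈ Finset.univ.erase i, |Q i p| = ∑ p, |Q i p| :=
    Finset.add_sum_erase _ (fun p => |Q i p|) (Finset.mem_univ i)
  have hdiag : |Q i i| ≤ ∑ p, |Q p p| :=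
    Finset.single_le_sum (f := fun p => |Q p p|) (fun p _ => abs_nonneg _) (Finset.mem_univ i)
  linarith

theorem case8_xi1_xj1_anc1 {n : ℕ} (Q : Matrix (Fin n) (Fin n) ℝ) (hQ : Q.IsSymm)
    (i j : Fin n) (hij : i ≠ j) (U : Finset (Fin n)) (hiU : i ∉ U) (hjU : j ∉ U)
    (hU : ∀ k ∈ U, Q i k = Q j k) (z : ℝ)
    (x : Fin n → ℝ) (hx : IsBinary x) (hxi : x i = 1) (hxj : x j = 1) :
    (energyMod Q i j U z x 1
      = energy Q x + z - Q i j - ∑ k ∈ U.filter (fun k => x k = 1), Q i k) ∧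
    (z = totalWeight Q → energyMod Q i j U z x 1 ≥ energy Q x) := by
  have hsymm : ∀ p q, Q p q = Q q p := fun p q => hQ.apply q p
  have hfilter : ∑ k ∈ U, x k * Q i k = ∑ k ∈ U.filter (fun k => x k = 1), Q i k := by
    rw [Finset.sum_filter]
    refine Finset.sum_congr rfl fun k _ => ?_
    rcases hx k with h | h <;> simp [h]
  have hmain : energyMod Q i j U z x 1
      = energy Q x + z - Q i j - ∑ k ∈ U.filter (fun k => x k = 1), Q i k := by
    rw [energyMod_eq hsymm, energy_coreMod hsymm hij hiU hjU hU, sum_mul_ancRow Q hij hiU hjU,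
      hfilter, hxi, hxj]
    ring
  refine ⟨hmain, fun hz => ?_⟩
  have hj : j ∉ U.filter (fun k => x k = 1) := fun h => hjU (Finset.mem_filter.mp h).1
  have hle : Q i j + ∑ k ∈ U.filter (fun k => x k = 1), Q i k ≤ totalWeight Q := by
    rw [← Finset.sum_insert hj]
    exact (Finset.sum_le_sum fun k _ => le_abs_self (Q i k)).trans
      ((Finset.sum_le_sum_of_subset_of_nonneg (Finset.subset_univ _)
        fun k _ _ => abs_nonneg _).trans (sum_abs_row_le_totalWeight hsymm i))
  rw [hmain, hz]
  linarith
end
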